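/- Let n be a natural number with n ≠ 4 and n ≠ 6, and let G = S_n be the symmetric group on n letters. Then the only table automorphism of G is the trivial one: if (σ, τ) is a table automorphism of G, then σ is the identity on the set of irreducible characters of G and τ is the identity on the set of conjugacy classes of G. -/

import Mathlib

/-- `f : G → ℂ` is an irreducible character of `G` if it is the character of some
irreducible (simple) finite-dimensional complex representation of `G`. -/
def IsIrrChar (G : Type) [Group G] (f : G → ℂ) : Prop :=
  ∃ V : FDRep ℂ G, CategoryTheory.Simple V ∧ f = V.character

/-- `(σ, τ)` is a table automorphism of `G`: `σ` permutes the irreducible characters,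
`τ` permutes the conjugacy classes, and for every irreducible character `f`, every `g`,
and every `h` whose conjugacy class is `τ` of the class of `g`, `(σ f) h = f g`. -/
def IsTableAut (G : Type) [Group G]
    (σ : Equiv.Perm {f : G → ℂ // IsIrrChar G f})
    (τ : Equiv.Perm (ConjClasses G)) : Prop :=
  ∀ (f : {f : G → ℂ // IsIrrChar G f}) (g h : G),
    ConjClasses.mk h = τ (ConjClasses.mk g) → (σ f).1 h = f.1 g

theorem simple_of_isIrreducible {G V : Type} [Group G] [Finite G] [AddCommGroup V] [Module ℂ V]
    [FiniteDimensional ℂ V] (ρ : Representation ℂ G V) (hρ : ρ.IsIrreducible) :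
    CategoryTheory.Simple (FDRep.of ρ) := by
  have := Fintype.ofFinite G
  have := invertibleOfNonzero (NeZero.ne (Nat.card G : ℂ))
  rw [FDRep.simple_iff_char_is_norm_one]
  have h := ρ.char_orthonormal ρ
  rw [if_pos ⟨Representation.Equiv.refl ρ⟩, inv_mul_eq_one₀ (NeZero.ne _)] at h
  exact h.symm

theorem exists_smul_one_of_commute {G : Type} [Group G] [Finite G] (V : FDRep ℂ G)
    (hV : CategoryTheory.Simple V) (A : V →ₗ[ℂ] V) (hA : ∀ g, A ∘ₗ V.ρ g = V.ρ g ∘ₗ A) :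
    ∃ c : ℂ, A = c • LinearMap.id := by
  have := Fintype.ofFinite G
  have := invertibleOfNonzero (NeZero.ne (Nat.card G : ℂ))
  have h1 := Representation.card_inv_mul_sum_char_mul_char_eq_finrank V.ρ V.ρ
  have h2 := (FDRep.simple_iff_char_is_norm_one V).1 hV
  have h3 : Module.finrank ℂ (Representation.IntertwiningMap V.ρ V.ρ) = 1 := by
    rw [← Nat.cast_inj (R := ℂ), ← h1, Nat.cast_one, inv_mul_eq_one₀ (NeZero.ne _)]
    exact h2.symm
  have hid : Representation.IntertwiningMap.id V.ρ ≠ 0 := by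
    intro h0
    have : Subsingleton (Representation.IntertwiningMap V.ρ V.ρ) := by
      refine subsingleton_of_forall_eq 0 fun f => ?_
      ext v
      have := congrArg (fun e : Representation.IntertwiningMap V.ρ V.ρ => f (e v)) h0
      simpa using this
    rw [Module.finrank_zero_of_subsingleton] at h3
    exact zero_ne_one h3
  obtain ⟨c, hc⟩ := (finrank_eq_one_iff_of_nonzero' _ hid).1 h3
    ⟨A, hA⟩
  refine ⟨c, ?_⟩
  have := congrArg Representation.IntertwiningMap.toLinearMap hc
  simpa using this.symm

theorem exists_sum_smul_eq_smul_one {G : Type} [Group G] [Fintype G] (V : FDRep ℂ G)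
    (hV : CategoryTheory.Simple V) (a : G → ℂ) (ha : ∀ g h, a (h * g * h⁻¹) = a g) :
    ∃ c : ℂ, ∑ g, a g • V.ρ g = c • LinearMap.id := by
  refine exists_smul_one_of_commute V hV _ fun h => ?_
  simp only [← Module.End.mul_eq_comp, Finset.sum_mul, Finset.mul_sum, smul_mul_assoc,
    mul_smul_comm]
  rw [← Equiv.sum_comp (MulAut.conj h).toEquiv]
  refine Finset.sum_congr rfl fun g _ => ?_
  simp only [MulEquiv.toEquiv_eq_coe, EquivLike.coe_coe, MulAut.conj_apply, ha]
  congr 1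
  rw [← map_mul, ← map_mul]
  simp

theorem sum_mul_char_mul_char_one {G : Type} [Group G] [Fintype G] {f : G → ℂ}
    (hf : IsIrrChar G f) (a : G → ℂ) (ha : ∀ g h, a (h * g * h⁻¹) = a g) (h : G) :
    (∑ g, a g * f (h * g)) * f 1 = (∑ g, a g * f g) * f h := by
  obtain ⟨V, hV, rfl⟩ := hf
  obtain ⟨c, hc⟩ := exists_sum_smul_eq_smul_one V hV a ha
  have key : ∀ h, ∑ g, a g * V.character (h * g) = c * V.character h := by
    intro h
    have := congrArg (fun B => LinearMap.trace ℂ V (V.ρ h * B)) hc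
    simpa [Finset.mul_sum, FDRep.character, ← Module.End.one_eq_id, Module.End.mul_eq_comp]
      using this
  have := key 1
  simp only [one_mul] at this
  rw [key, this]
  ring

theorem isIrrChar_one (G : Type) [Group G] [Finite G] : IsIrrChar G 1 := by
  have := Fintype.ofFinite G
  refine ⟨FDRep.of (Representation.trivial ℂ G ℂ), ?_, ?_⟩
  · rw [FDRep.simple_iff_char_is_norm_one]
    simp [FDRep.character]
  · ext g
    simp [FDRep.character]

theorem IsIrrChar.sum_mul_inv {G : Type} [Group G] [Fintype G] {f f' : G → ℂ}
    (hf : IsIrrChar G f) (hf' : IsIrrChar G f') :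
    ∑ g, f g * f' g⁻¹ = if f = f' then (Nat.card G : ℂ) else 0 := by
  classical
  have := invertibleOfNonzero (NeZero.ne (Nat.card G : ℂ))
  obtain ⟨V, hV, rfl⟩ := hf
  obtain ⟨W, hW, rfl⟩ := hf'
  split_ifs with h
  · rw [← h]
    exact (FDRep.simple_iff_char_is_norm_one V).1 hV
  · have := FDRep.char_orthonormal V W
    rw [if_neg fun ⟨i⟩ => h (FDRep.char_iso i)] at this
    simpa using this

theorem IsIrrChar.conj {G : Type} [Group G] {f : G → ℂ} (hf : IsIrrChar G f) {g h : G}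
    (hgh : IsConj g h) : f g = f h := by
  obtain ⟨V, hV, rfl⟩ := hf
  obtain ⟨c, rfl⟩ := isConj_iff.1 hgh
  simp

theorem IsIrrChar.one_eq {G : Type} [Group G] {f : G → ℂ} (hf : IsIrrChar G f) :
    ∃ n : ℕ, f 1 = n := by
  obtain ⟨V, hV, rfl⟩ := hf
  exact ⟨_, V.char_one⟩

theorem IsIrrChar.one_ne_zero {G : Type} [Group G] [Finite G] {f : G → ℂ} (hf : IsIrrChar G f) :
    f 1 ≠ 0 := by
  have := Fintype.ofFinite G
  intro h0
  have h := hf.sum_mul_inv hf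
  obtain ⟨V, hV, rfl⟩ := hf
  rw [FDRep.char_one, Nat.cast_eq_zero] at h0
  have := Module.finrank_zero_iff.1 h0
  have h1 : ∀ g, V.character g = 0 := fun g => by
    rw [FDRep.character, Subsingleton.elim (V.ρ g) 0, map_zero]
  simp only [h1, zero_mul, Finset.sum_const_zero, if_true] at h
  exact NeZero.ne _ h.symm

theorem sum_smul_eq_zero_of_sum_mul_char {G : Type} [Group G] [Fintype G] (V : FDRep ℂ G)
    (hV : CategoryTheory.Simple V) (a : G → ℂ) (ha : ∀ g h, a (h * g * h⁻¹) = a g)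
    (h0 : ∑ g, a g * V.character g = 0) : ∑ g, a g • V.ρ g = 0 := by
  obtain ⟨c, hc⟩ := exists_sum_smul_eq_smul_one V hV a ha
  have h1 := congrArg (LinearMap.trace ℂ V) hc
  have h2 : V.character 1 ≠ 0 := IsIrrChar.one_ne_zero ⟨V, hV, rfl⟩
  have h3 : c = 0 ∨ V.character 1 = 0 := by
    rw [← mul_eq_zero, ← h0, FDRep.char_one]
    simpa [FDRep.character, ← Module.End.one_eq_id] using h1.symm
  rw [hc, h3.resolve_right h2, zero_smul]

theorem sum_single_smul_eq_zero {G : Type} [Group G] [Fintype G] {M : Type} [AddCommGroup M]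
    [Module ℂ M] [FiniteDimensional ℂ M] [Module (MonoidAlgebra ℂ G) M]
    [IsScalarTower ℂ (MonoidAlgebra ℂ G) M] (hM : IsSimpleModule (MonoidAlgebra ℂ G) M)
    (a : G → ℂ) (ha : ∀ g h, a (h * g * h⁻¹) = a g)
    (h0 : ∀ f, IsIrrChar G f → ∑ g, a g * f g = 0) (v : M) :
    (∑ g, MonoidAlgebra.single g (a g)) • v = 0 := by
  let ρ := Representation.ofModule' (k := ℂ) (G := G) M
  have hρ' : ρ.asAlgebraHom = Algebra.lsmul ℂ ℂ M := Equiv.apply_symm_apply _ _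
  let e : ρ.asModule ≃ₗ[MonoidAlgebra ℂ G] M :=
    { ρ.asModuleEquiv.toAddEquiv with
      map_smul' := fun r x => by
        have := ρ.asModuleEquiv_map_smul r x
        rw [hρ'] at this
        exact this }
  have hρ : ρ.IsIrreducible := by
    rw [Representation.irreducible_iff_isSimpleModule_asModule]
    exact IsSimpleModule.congr e
  have h2 := sum_smul_eq_zero_of_sum_mul_char (FDRep.of ρ) (simple_of_isIrreducible ρ hρ) a ha
    (h0 _ ⟨_, simple_of_isIrreducible ρ hρ, rfl⟩)
  have h3 : ρ.asAlgebraHom (∑ g, MonoidAlgebra.single g (a g)) = 0 := by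
    simp only [map_sum, Representation.asAlgebraHom_single]
    exact h2
  rw [hρ'] at h3
  exact DFunLike.congr_fun h3 v

/-- A class function orthogonal to all irreducible characters vanishes. -/
theorem eq_zero_of_forall_sum_mul_char {G : Type} [Group G] [Fintype G]
    (a : G → ℂ) (ha : ∀ g h, a (h * g * h⁻¹) = a g)
    (h0 : ∀ f, IsIrrChar G f → ∑ g, a g * f g = 0) : a = 0 := by
  set x : MonoidAlgebra ℂ G := ∑ g, MonoidAlgebra.single g (a g) with hx
  have hmem : x ∈ Ring.jacobson (MonoidAlgebra ℂ G) := by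
    refine Submodule.mem_sInf.2 fun m hm => ?_
    have : FiniteDimensional ℂ (MonoidAlgebra ℂ G ⧸ m) := Module.Finite.trans (MonoidAlgebra ℂ G) _
    have h4 := sum_single_smul_eq_zero (M := MonoidAlgebra ℂ G ⧸ m)
      (isSimpleModule_iff_isCoatom.2 hm) a ha h0 (Submodule.Quotient.mk 1)
    rw [← Submodule.Quotient.mk_smul, Submodule.Quotient.mk_eq_zero] at h4
    simpa using h4
  rw [Ring.jacobson, IsSemisimpleModule.jacobson_eq_bot, Submodule.mem_bot] at hmem
  ext g
  have := congrArg (fun y : MonoidAlgebra ℂ G => y.coeff g) hmem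
  classical
  simpa [hx, Finsupp.single_apply] using this

theorem span_irrChar_eq_top (G : Type) [Group G] [Finite G] :
    Submodule.span ℂ {p : ConjClasses G → ℂ | IsIrrChar G (p ∘ ConjClasses.mk)} = ⊤ := by
  classical
  have := Fintype.ofFinite G
  have := Fintype.ofFinite (ConjClasses G)
  by_contra hne
  obtain ⟨φ, hφ, hle⟩ := Submodule.exists_le_ker_of_lt_top _ (lt_top_iff_ne_top.2 hne)
  let N : ConjClasses G → ℕ := fun c => (Finset.univ.filter fun g : G => ConjClasses.mk g = c).card
  have hN : ∀ g : G, (N (ConjClasses.mk g) : ℂ) ≠ 0 := fun g => by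
    rw [Nat.cast_ne_zero]
    exact Finset.card_ne_zero_of_mem (Finset.mem_filter.2 ⟨Finset.mem_univ g, rfl⟩)
  let a : G → ℂ := fun g => φ (Pi.single (ConjClasses.mk g) 1) / N (ConjClasses.mk g)
  have hsum : ∀ q : ConjClasses G → ℂ, ∑ g, a g * q (ConjClasses.mk g) = φ q := by
    intro q
    conv_rhs => rw [LinearMap.pi_apply_eq_sum_univ φ q]
    rw [← Finset.sum_fiberwise Finset.univ (ConjClasses.mk : G → ConjClasses G)]
    refine Finset.sum_congr rfl fun c _ => ?_
    have hc : (fun j => if c = j then (1 : ℂ) else 0) = Pi.single c 1 := by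
      ext j
      simp [Pi.single_apply, eq_comm]
    rw [hc, Finset.sum_congr rfl (g := fun _ => φ (Pi.single c 1) / N c * q c)]
    · obtain ⟨g, rfl⟩ := ConjClasses.exists_rep c
      rw [Finset.sum_const, nsmul_eq_mul, smul_eq_mul]
      change (N (ConjClasses.mk g) : ℂ) * _ = _
      field_simp [hN g]
    · intro g hg
      simp only [Finset.mem_filter, Finset.mem_univ, true_and] at hg
      simp [a, hg]
  have ha : a = 0 := by
    refine eq_zero_of_forall_sum_mul_char a (fun g h => ?_) fun f hf => ?_
    · have : ConjClasses.mk (h * g * h⁻¹) = ConjClasses.mk g :=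
        ConjClasses.mk_eq_mk_iff_isConj.2 (isConj_iff.2 ⟨h, rfl⟩).symm
      simp only [a, this]
    · let q : ConjClasses G → ℂ := Quotient.lift f fun _ _ h => hf.conj h
      have hq : q ∈ LinearMap.ker φ := hle (Submodule.subset_span hf)
      rw [← LinearMap.mem_ker.1 hq, ← hsum]
      rfl
  refine hφ (LinearMap.ext fun q => ?_)
  rw [← hsum, ha]
  simp

theorem linearMap_ext_irrChar {G : Type} [Group G] [Finite G] {φ ψ : (ConjClasses G → ℂ) →ₗ[ℂ] ℂ}
    (h : ∀ p : ConjClasses G → ℂ, IsIrrChar G (p ∘ ConjClasses.mk) → φ p = ψ p) : φ = ψ :=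
  LinearMap.ext_on (span_irrChar_eq_top G) h

theorem IsIrrChar.sum_eq {G : Type} [Group G] [Fintype G] [DecidableEq (G → ℂ)] {f : G → ℂ}
    (hf : IsIrrChar G f) : ∑ g, f g = if f = 1 then (Nat.card G : ℂ) else 0 := by
  have := hf.sum_mul_inv (isIrrChar_one G)
  simpa using this

namespace IsTableAut

variable {G : Type} [Group G] {σ : Equiv.Perm {f : G → ℂ // IsIrrChar G f}}
  {τ : Equiv.Perm (ConjClasses G)}

theorem symm_apply (h : IsTableAut G σ τ) {p : ConjClasses G → ℂ}
    (hp : IsIrrChar G (p ∘ ConjClasses.mk)) :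
    (σ.symm ⟨p ∘ ConjClasses.mk, hp⟩).1 = p ∘ τ ∘ ConjClasses.mk := by
  ext g
  obtain ⟨k, hk⟩ := ConjClasses.exists_rep (τ (ConjClasses.mk g))
  rw [← h _ g k hk, Equiv.apply_symm_apply]
  simp [hk]

theorem isIrrChar_comp (h : IsTableAut G σ τ) {p : ConjClasses G → ℂ}
    (hp : IsIrrChar G (p ∘ ConjClasses.mk)) : IsIrrChar G (p ∘ τ ∘ ConjClasses.mk) := by
  rw [← h.symm_apply hp]
  exact (σ.symm ⟨_, hp⟩).2

theorem sum_comp [Fintype G] (h : IsTableAut G σ τ) (p : ConjClasses G → ℂ) :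
    ∑ g : G, p (τ (ConjClasses.mk g)) = ∑ g : G, p (ConjClasses.mk g) := by
  classical
  let ev : ConjClasses G → ((ConjClasses G → ℂ) →ₗ[ℂ] ℂ) := LinearMap.proj
  have : ∑ g : G, ev (τ (ConjClasses.mk g)) = ∑ g : G, ev (ConjClasses.mk g) := by
    refine linearMap_ext_irrChar fun p hp => ?_
    have h1 := hp.sum_eq
    have h2 := (h.isIrrChar_comp hp).sum_eq
    simp only [LinearMap.sum_apply, ev, LinearMap.proj_apply]
    refine h2.trans (Eq.trans ?_ h1.symm)
    have : p ∘ τ ∘ ConjClasses.mk = (1 : G → ℂ) ↔ p ∘ ConjClasses.mk = (1 : G → ℂ) := by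
      simp only [funext_iff, Function.comp_apply, Pi.one_apply]
      constructor <;> intro hh g
      · obtain ⟨k, hk⟩ := ConjClasses.exists_rep (τ.symm (ConjClasses.mk g))
        simpa [hk] using hh k
      · obtain ⟨k, hk⟩ := ConjClasses.exists_rep (τ (ConjClasses.mk g))
        simpa [hk] using hh k
    simp only [this]
  simpa [ev] using congrArg (fun φ => φ p) this

theorem card_eq [Fintype G] [DecidableEq (ConjClasses G)] (h : IsTableAut G σ τ)
    (c : ConjClasses G) :
    (Finset.univ.filter fun g : G => ConjClasses.mk g = τ c).card =
      (Finset.univ.filter fun g : G => ConjClasses.mk g = c).card := by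
  have := h.sum_comp (Pi.single (τ c) 1)
  simp only [Pi.single_apply, EmbeddingLike.apply_eq_iff_eq, Finset.sum_boole] at this
  exact_mod_cast this.symm

theorem sum_mul_right [Fintype G] [DecidableEq (ConjClasses G)] (h : IsTableAut G σ τ)
    (h1 : τ (ConjClasses.mk 1) = ConjClasses.mk 1) {c : ConjClasses G} (hc : τ c = c)
    (p : ConjClasses G → ℂ) {g k : G}
    (hgk : ConjClasses.mk k = τ (ConjClasses.mk g)) :
    ∑ t : G with ConjClasses.mk t = c, p (τ (ConjClasses.mk (g * t))) =
      ∑ t : G with ConjClasses.mk t = c, p (ConjClasses.mk (k * t)) := by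
  let ev : ConjClasses G → ((ConjClasses G → ℂ) →ₗ[ℂ] ℂ) := LinearMap.proj
  have : ∑ t : G with ConjClasses.mk t = c, ev (τ (ConjClasses.mk (g * t))) =
      ∑ t : G with ConjClasses.mk t = c, ev (ConjClasses.mk (k * t)) := by
    refine linearMap_ext_irrChar fun p hp => ?_
    have ha : ∀ g h : G, (if ConjClasses.mk (h * g * h⁻¹) = c then (1 : ℂ) else 0) =
        if ConjClasses.mk g = c then 1 else 0 := fun g h => by
      rw [ConjClasses.mk_eq_mk_iff_isConj.2 (isConj_iff.2 ⟨h, rfl⟩ : IsConj g _).symm]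
    have e1 := sum_mul_char_mul_char_one (h.isIrrChar_comp hp)
      (fun g => if ConjClasses.mk g = c then 1 else 0) ha g
    have e2 := sum_mul_char_mul_char_one hp
      (fun g => if ConjClasses.mk g = c then 1 else 0) ha k
    simp only [ite_mul, one_mul, zero_mul, ← Finset.sum_filter, Function.comp_apply, h1,
      ← hgk] at e1 e2
    have e3 : ∑ t : G with ConjClasses.mk t = c, p (τ (ConjClasses.mk t)) =
        ∑ t : G with ConjClasses.mk t = c, p (ConjClasses.mk t) :=
      Finset.sum_congr rfl fun t ht => by
        rw [(Finset.mem_filter.1 ht).2, hc]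
    rw [e3, ← e2] at e1
    simpa [ev] using mul_right_cancel₀ hp.one_ne_zero e1
  simpa [ev] using congrArg (fun φ => φ p) this

/-- For a class `c` and a set `S` of classes both fixed by a table automorphism, the number of
elements of `c` that move `g` into `S` depends only on the orbit of the class of `g`. -/
theorem card_mul_right [Fintype G] [DecidableEq (ConjClasses G)] (h : IsTableAut G σ τ)
    (h1 : τ (ConjClasses.mk 1) = ConjClasses.mk 1) {c : ConjClasses G} (hc : τ c = c)
    (S : ConjClasses G → Prop) [DecidablePred S]
    (hS : ∀ d, S (τ d) ↔ S d) {g k : G} (hgk : ConjClasses.mk k = τ (ConjClasses.mk g)) :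
    (Finset.univ.filter fun t : G => ConjClasses.mk t = c ∧ S (ConjClasses.mk (g * t))).card =
      (Finset.univ.filter fun t : G => ConjClasses.mk t = c ∧ S (ConjClasses.mk (k * t))).card := by
  have := h.sum_mul_right h1 hc (fun d => if S d then 1 else 0) hgk
  simp only [hS, Finset.sum_boole, Finset.filter_filter] at this
  exact_mod_cast this

end IsTableAut

/-- The vectors with coordinate sum zero. -/
def sumZero (n : ℕ) : Submodule ℂ (Fin n → ℂ) := LinearMap.ker (∑ i, LinearMap.proj i)

theorem mem_sumZero {n : ℕ} {w : Fin n → ℂ} : w ∈ sumZero n ↔ ∑ i, w i = 0 := by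
  simp [sumZero]

/-- The standard representation of the symmetric group on the vectors with coordinate sum zero. -/
def stdRep (n : ℕ) : Representation ℂ (Equiv.Perm (Fin n)) (sumZero n) where
  toFun g := (LinearMap.funLeft ℂ ℂ (g⁻¹ : Equiv.Perm (Fin n))).restrict fun w hw => by
    rw [mem_sumZero] at hw ⊢
    rw [← hw]
    exact Equiv.sum_comp g⁻¹ w
  map_one' := by
    ext w x
    simp [LinearMap.funLeft_apply]
  map_mul' g h := by
    ext w x
    simp [LinearMap.funLeft_apply]

theorem stdRep_apply {n : ℕ} (g : Equiv.Perm (Fin n)) (w : sumZero n) (x : Fin n) :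
    (stdRep n g w).1 x = w.1 (g⁻¹ x) := rfl

/-- The difference of two coordinate vectors. -/
def coordDiff {n : ℕ} (i j : Fin n) : sumZero n :=
  ⟨Pi.single i 1 - Pi.single j 1, by simp [mem_sumZero]⟩

theorem stdRep_coordDiff {n : ℕ} (g : Equiv.Perm (Fin n)) (i j : Fin n) :
    stdRep n g (coordDiff i j) = coordDiff (g i) (g j) := by
  ext x
  simp only [stdRep_apply, coordDiff, Pi.sub_apply, Pi.single_apply, Equiv.Perm.inv_eq_iff_eq]

theorem sum_smul_coordDiff {n : ℕ} (w : sumZero n) (j : Fin n) :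
    ∑ i, w.1 i • coordDiff i j = w := by
  ext x
  have := mem_sumZero.1 w.2
  simp [coordDiff, Finset.sum_apply, mul_sub, Finset.sum_sub_distrib, this,
    Pi.single_apply]

theorem sub_stdRep_swap {n : ℕ} (w : sumZero n) (i j : Fin n) :
    w - stdRep n (Equiv.swap i j) w = (w.1 i - w.1 j) • coordDiff i j := by
  ext x
  simp only [coordDiff, Submodule.coe_sub, Pi.sub_apply, stdRep_apply, Equiv.swap_inv,
    Submodule.coe_smul, Pi.smul_apply, smul_eq_mul, Pi.single_apply, Equiv.swap_apply_def]
  split_ifs <;> simp_all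

theorem stdRep_isIrreducible {n : ℕ} (hn : 2 ≤ n) : (stdRep n).IsIrreducible := by
  have hnt : Nontrivial (Subrepresentation (stdRep n)) := by
    refine ⟨⊥, ⊤, fun hbt => ?_⟩
    have h1 : coordDiff (⟨0, by omega⟩ : Fin n) ⟨1, by omega⟩ ∈
        (⊤ : Subrepresentation (stdRep n)).toSubmodule := Submodule.mem_top
    rw [← hbt] at h1
    have h2 := congrFun (congrArg Subtype.val ((Submodule.mem_bot ℂ).1 h1)) ⟨0, by omega⟩
    simp [coordDiff] at h2
  refine { eq_bot_or_eq_top := fun U => ?_ }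
  by_cases hU : ∀ w ∈ U, w = 0
  · exact Or.inl (Subrepresentation.toSubmodule_injective ((Submodule.eq_bot_iff _).2 hU))
  right
  push Not at hU
  obtain ⟨w, hw, hw0⟩ := hU
  obtain ⟨i, j, hij⟩ : ∃ i j, w.1 i ≠ w.1 j := by
    by_contra! hc
    refine hw0 (Subtype.ext (funext fun i => ?_))
    have := mem_sumZero.1 w.2
    rw [Finset.sum_congr rfl fun j _ => hc j i, Finset.sum_const, Finset.card_univ,
      Fintype.card_fin, nsmul_eq_mul, mul_eq_zero] at this
    exact this.resolve_left (Nat.cast_ne_zero.2 (by omega))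
  have hd : coordDiff i j ∈ U.toSubmodule := by
    rw [← U.toSubmodule.smul_mem_iff (sub_ne_zero.2 hij), ← sub_stdRep_swap]
    exact U.toSubmodule.sub_mem hw (U.apply_mem_toSubmodule _ hw)
  have hd' : ∀ k, coordDiff k j ∈ U.toSubmodule := by
    intro k
    by_cases hk : k = j
    · have : coordDiff k j = 0 := by
        ext; simp [hk, coordDiff]
      rw [this]
      exact U.toSubmodule.zero_mem
    · have := U.apply_mem_toSubmodule (Equiv.swap i k) hd
      rwa [stdRep_coordDiff, Equiv.swap_apply_left, Equiv.swap_apply_of_ne_of_ne _ (Ne.symm hk)]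
        at this
      rintro rfl
      exact hij rfl
  refine Subrepresentation.toSubmodule_injective (Submodule.eq_top_iff'.2 fun w => ?_)
  rw [← sum_smul_coordDiff w j]
  exact Submodule.sum_mem _ fun k _ => Submodule.smul_mem _ _ (hd' k)

theorem stdRep_character (n : ℕ) (hn : n ≠ 0) (g : Equiv.Perm (Fin n)) :
    (stdRep n).character g = (Finset.univ.filter fun x => g x = x).card - 1 := by
  let J : (Fin n → ℂ) →ₗ[ℂ] (Fin n → ℂ) :=
    LinearMap.pi fun _ => (n : ℂ)⁻¹ • ∑ i, LinearMap.proj i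
  have hJ : ∀ w, w - J w ∈ sumZero n := by
    intro w
    simp [mem_sumZero, J, hn]
  let π : (Fin n → ℂ) →ₗ[ℂ] sumZero n := (LinearMap.id - J).codRestrict _ hJ
  let P : (Fin n → ℂ) →ₗ[ℂ] (Fin n → ℂ) := LinearMap.funLeft ℂ ℂ (g⁻¹ : Equiv.Perm (Fin n))
  have h1 : stdRep n g = π ∘ₗ (P ∘ₗ (sumZero n).subtype) := by
    ext w x
    have hw : ∑ i, w.1 (g⁻¹ i) = 0 := (Equiv.sum_comp g⁻¹ w.1).trans (mem_sumZero.1 w.2)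
    simp only [π, P, J, LinearMap.comp_apply, Submodule.subtype_apply, LinearMap.codRestrict_apply,
      LinearMap.sub_apply, LinearMap.id_apply, Pi.sub_apply, LinearMap.pi_apply,
      LinearMap.smul_apply, LinearMap.sum_apply, LinearMap.proj_apply, LinearMap.funLeft_apply, hw,
      smul_zero, sub_zero, stdRep_apply]
  have hP : LinearMap.trace ℂ _ P = (Finset.univ.filter fun x => g x = x).card := by
    rw [LinearMap.trace_eq_matrix_trace ℂ (Pi.basisFun ℂ (Fin n)), Matrix.trace]
    simp only [P, Matrix.diag_apply, LinearMap.toMatrix_apply, LinearMap.funLeft_apply,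
      Pi.basisFun_apply, Pi.basisFun_repr, Pi.single_apply, Equiv.Perm.inv_eq_iff_eq,
      Finset.sum_boole]
    simp only [eq_comm]
  have hJP : LinearMap.trace ℂ _ (P ∘ₗ J) = 1 := by
    rw [LinearMap.trace_eq_matrix_trace ℂ (Pi.basisFun ℂ (Fin n)), Matrix.trace]
    simp [P, J, LinearMap.funLeft_apply, Pi.single_apply, hn]
  rw [Representation.character, h1, LinearMap.trace_comp_comm', LinearMap.comp_assoc]
  have h2 : (sumZero n).subtype ∘ₗ π = LinearMap.id - J := by
    ext; rfl
  rw [h2, LinearMap.comp_sub, map_sub, LinearMap.comp_id, hP, hJP]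

theorem doubleFactorial_monotone : Monotone Nat.doubleFactorial := by
  refine monotone_nat_of_le_succ fun n => ?_
  induction n using Nat.twoStepInduction with
  | zero => simp
  | one => simp [Nat.doubleFactorial]
  | more n ih _ =>
    rw [Nat.doubleFactorial_add_two, show n + 2 + 1 = n + 1 + 2 from rfl,
      Nat.doubleFactorial_add_two]
    exact Nat.mul_le_mul (by omega) ih

theorem prod_factorial_count_cons (j : ℕ) (m : Multiset ℕ) :
    ∏ k ∈ (j ::ₘ m).toFinset, ((j ::ₘ m).count k).factorial =
      (∏ k ∈ m.toFinset, (m.count k).factorial) * (m.count j + 1) := by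
  have h1 : ∏ k ∈ m.toFinset, (m.count k).factorial =
      ∏ k ∈ (j ::ₘ m).toFinset, (m.count k).factorial := by
    refine Finset.prod_subset (by simp) fun k _ hk => ?_
    rw [Multiset.count_eq_zero.2 (by simpa using hk), Nat.factorial_zero]
  have hj : j ∈ (j ::ₘ m).toFinset := by simp
  rw [h1, ← Finset.mul_prod_erase _ _ hj, ← Finset.mul_prod_erase _ _ hj, Multiset.count_cons_self,
    Nat.factorial_succ, Finset.prod_congr rfl fun k hk => by
      rw [Multiset.count_cons_of_ne (Finset.ne_of_mem_erase hk)]]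
  ring

theorem mul_count_le_sum (j : ℕ) (m : Multiset ℕ) : j * m.count j ≤ m.sum := by
  induction m using Multiset.induction with
  | empty => simp
  | cons a m ih =>
    rw [Multiset.sum_cons, Multiset.count_cons]
    split_ifs with h
    · subst h
      linarith
    · rw [add_zero]
      omega

/-- The centralizer of a fixed-point-free permutation with cycle type `m` has at most `m.sum‼`
elements. -/
theorem prod_mul_prod_factorial_count_le (m : Multiset ℕ) (hm : ∀ a ∈ m, 2 ≤ a) :
    m.prod * ∏ k ∈ m.toFinset, (m.count k).factorial ≤ m.sum.doubleFactorial := by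
  induction m using Multiset.induction with
  | empty => simp
  | cons j m ih =>
    obtain ⟨i, rfl⟩ := Nat.exists_eq_add_of_le' (hm j (by simp))
    have hc := mul_count_le_sum (i + 2) m
    rw [prod_factorial_count_cons, Multiset.prod_cons, Multiset.sum_cons,
      show i + 2 + m.sum = i + m.sum + 2 by ring, Nat.doubleFactorial_add_two]
    calc (i + 2) * m.prod *
          ((∏ k ∈ m.toFinset, (m.count k).factorial) * (m.count (i + 2) + 1))
        = (i + 2) * (m.count (i + 2) + 1) *
          (m.prod * ∏ k ∈ m.toFinset, (m.count k).factorial) := by ring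
      _ ≤ (i + m.sum + 2) * (i + m.sum).doubleFactorial :=
        Nat.mul_le_mul (by linarith) ((ih fun a ha => hm a (by simp [ha])).trans
          (doubleFactorial_monotone (by omega)))

theorem factorial_mul_doubleFactorial_step {k b : ℕ} (hb : 1 ≤ b)
    (h : k.factorial * (b + 2).doubleFactorial < 2 * (k + b).factorial) :
    k.factorial * (b + 2 + 2).doubleFactorial < 2 * (k + (b + 2)).factorial := by
  rw [Nat.doubleFactorial_add_two, ← add_assoc, Nat.factorial_succ, Nat.factorial_succ]
  have h1 : b + 2 + 2 ≤ (k + b + 1 + 1) * (k + b + 1) := by nlinarith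
  calc k.factorial * ((b + 2 + 2) * (b + 2).doubleFactorial)
      = (b + 2 + 2) * (k.factorial * (b + 2).doubleFactorial) := by ring
    _ < (b + 2 + 2) * (2 * (k + b).factorial) := Nat.mul_lt_mul_of_pos_left h (by omega)
    _ ≤ (k + b + 1 + 1) * (k + b + 1) * (2 * (k + b).factorial) := Nat.mul_le_mul_right _ h1
    _ = _ := by ring

theorem succ_factorial_mul_doubleFactorial_lt (k b : ℕ) :
    (k + 1).factorial * (b + 1 + 2).doubleFactorial < 2 * (k + 1 + (b + 1)).factorial := by
  induction b using Nat.twoStepInduction with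
  | zero =>
    simp [Nat.doubleFactorial, Nat.factorial_succ]
    nlinarith [Nat.factorial_pos k, mul_pos (Nat.factorial_pos k) (Nat.succ_pos k)]
  | one =>
    simp [Nat.doubleFactorial, Nat.factorial_succ]
    have := Nat.factorial_pos k
    have h2 : 8 < 2 * ((k + 1 + 1 + 1) * (k + 1 + 1)) := by nlinarith
    nlinarith [mul_pos (Nat.factorial_pos k) (Nat.succ_pos k)]
  | more b ih _ => exact factorial_mul_doubleFactorial_step (by omega) ih

theorem doubleFactorial_lt (b : ℕ) : (b + 5 + 2).doubleFactorial < 2 * (b + 5).factorial := by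
  induction b using Nat.twoStepInduction with
  | zero => decide
  | one => decide
  | more b ih _ =>
    have := factorial_mul_doubleFactorial_step (k := 0) (b := b + 5) (by omega) (by simpa using ih)
    rw [Nat.factorial_zero, one_mul, zero_add] at this
    exact this

theorem factorial_mul_prod_ne {n : ℕ} (hn : 3 ≤ n) (h4 : n ≠ 4) (h6 : n ≠ 6) {m : Multiset ℕ}
    (hm : ∀ a ∈ m, 2 ≤ a) (h3 : 3 ≤ m.sum) (hmn : m.sum ≤ n) :
    (n - m.sum).factorial * m.prod * ∏ k ∈ m.toFinset, (m.count k).factorial ≠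
      2 * (n - 2).factorial := by
  by_cases h35 : m.sum = n ∧ (n = 3 ∨ n = 5)
  · have hc : m.card * 2 ≤ m.sum := by
      simpa using Multiset.card_nsmul_le_sum hm
    have hc2 : m.card ≤ 2 := by omega
    interval_cases hcard : m.card
    · rw [Multiset.card_eq_zero] at hcard
      simp [hcard] at h3
    · obtain ⟨a, rfl⟩ := Multiset.card_eq_one.1 hcard
      rw [Multiset.sum_singleton] at h35
      obtain ⟨rfl, rfl | rfl⟩ := h35 <;> decide
    · obtain ⟨a, b, rfl⟩ := Multiset.card_eq_two.1 hcard
      have ha := hm a (by simp)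
      have hb := hm b (by simp)
      have hs : a + b = 5 := by
        have : a + b = n := by simpa using h35.1
        omega
      obtain ⟨h5, rfl | rfl⟩ := h35
      · simp at h5; omega
      · obtain ⟨rfl, rfl⟩ | ⟨rfl, rfl⟩ : (a = 2 ∧ b = 3) ∨ (a = 3 ∧ b = 2) := by omega
        · decide
        · decide
  · refine ne_of_lt ?_
    rw [mul_assoc]
    refine (Nat.mul_le_mul_left _ (prod_mul_prod_factorial_count_le m hm)).trans_lt ?_
    generalize m.sum = b at *
    obtain ⟨k, rfl⟩ := Nat.exists_eq_add_of_le hmn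
    rw [Nat.add_sub_cancel_left]
    obtain ⟨c, rfl⟩ := Nat.exists_eq_add_of_le' h3
    rcases k with _ | k
    · obtain ⟨d, rfl⟩ : ∃ d, c = d + 4 := ⟨c - 4, by omega⟩
      simpa using doubleFactorial_lt d
    · have := succ_factorial_mul_doubleFactorial_lt k c
      rwa [show c + 3 + (k + 1) - 2 = k + 1 + (c + 1) by omega]

theorem cycleType_eq_of_card_isConj_eq {n : ℕ} (hn : 3 ≤ n) (h4 : n ≠ 4) (h6 : n ≠ 6)
    {g t : Equiv.Perm (Fin n)} (hg : g ≠ 1) (ht : t.cycleType = {2})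
    (h : Nat.card {k | IsConj g k} = Nat.card {k | IsConj t k}) : g.cycleType = {2} := by
  have e1 := Equiv.Perm.card_isConj_mul_eq g
  rw [← Equiv.Perm.card_isConj_mul_eq t, h] at e1
  have e2 := Nat.eq_of_mul_eq_mul_left (Nat.card_pos_iff.2 ⟨⟨⟨t, IsConj.refl t⟩⟩, inferInstance⟩) e1
  have hm : ∀ a ∈ g.cycleType, 2 ≤ a := fun a => Equiv.Perm.two_le_of_mem_cycleType
  have hs : g.cycleType.sum ≤ n := by
    simpa [Equiv.Perm.sum_cycleType] using Finset.card_le_univ g.support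
  by_cases h3 : 3 ≤ g.cycleType.sum
  · refine absurd ?_ (factorial_mul_prod_ne hn h4 h6 hm h3 hs)
    simpa [ht, mul_comm] using e2
  · rw [← Equiv.Perm.isSwap_iff_cycleType, ← Equiv.Perm.card_support_eq_two]
    have := Equiv.Perm.two_le_card_support_of_ne_one hg
    rw [Equiv.Perm.sum_cycleType] at h3
    omega

theorem IsTableAut.card_mul_right_of_iff {G : Type} [Group G] [Fintype G]
    {σ : Equiv.Perm {f : G → ℂ // IsIrrChar G f}} {τ : Equiv.Perm (ConjClasses G)}
    (h : IsTableAut G σ τ) (h1 : τ (ConjClasses.mk 1) = ConjClasses.mk 1)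
    {t₀ : G} (ht : τ (ConjClasses.mk t₀) = ConjClasses.mk t₀) {P Q : G → Prop} [DecidablePred P]
    [DecidablePred Q] (hQ : ∀ t, Q t ↔ IsConj t t₀)
    (hP : ∀ x y, ConjClasses.mk y = τ (ConjClasses.mk x) → (P y ↔ P x)) {g k : G}
    (hgk : ConjClasses.mk k = τ (ConjClasses.mk g)) :
    (Finset.univ.filter fun t => Q t ∧ P (g * t)).card =
      (Finset.univ.filter fun t => Q t ∧ P (k * t)).card := by
  classical
  have hPP : ∀ x y, ConjClasses.mk x = ConjClasses.mk y → P x → P y := fun x y hxy hx => by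
    obtain ⟨z, hz⟩ := ConjClasses.exists_rep (τ.symm (ConjClasses.mk x))
    have hz' : ConjClasses.mk x = τ (ConjClasses.mk z) := by
      rw [show ConjClasses.mk z = _ from hz, Equiv.apply_symm_apply]
    exact (hP z y (hxy ▸ hz')).2 ((hP z x hz').1 hx)
  have hS : ∀ x, (∃ y, ConjClasses.mk y = ConjClasses.mk x ∧ P y) ↔ P x := fun x =>
    ⟨fun ⟨y, hy, hPy⟩ => hPP y x hy hPy, fun hx => ⟨x, rfl, hx⟩⟩
  have := h.card_mul_right h1 ht (fun d => ∃ x, ConjClasses.mk x = d ∧ P x) (fun d => by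
    obtain ⟨x, rfl⟩ := ConjClasses.exists_rep d
    obtain ⟨y, hy⟩ := ConjClasses.exists_rep (τ (ConjClasses.mk x))
    change _ ↔ ∃ y, ConjClasses.mk y = ConjClasses.mk x ∧ P y
    change (∃ z, ConjClasses.mk z = τ (ConjClasses.mk x) ∧ P z) ↔ _
    rw [← show ConjClasses.mk y = _ from hy, hS, hS]
    exact hP x y hy) hgk
  simpa only [hS, ConjClasses.mk_eq_mk_iff_isConj (a := (_ : G)) (b := t₀), ← hQ] using this

/-- An irreducible character as a function on conjugacy classes. -/
def IsIrrChar.classFun {G : Type} [Group G] {f : G → ℂ} (hf : IsIrrChar G f) : ConjClasses G → ℂ :=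
  Quotient.lift f fun _ _ h => hf.conj h

theorem IsIrrChar.classFun_mk {G : Type} [Group G] {f : G → ℂ} (hf : IsIrrChar G f) (g : G) :
    hf.classFun (ConjClasses.mk g) = f g := rfl

theorem IsIrrChar.classFun_comp_mk {G : Type} [Group G] {f : G → ℂ} (hf : IsIrrChar G f) :
    IsIrrChar G (hf.classFun ∘ ConjClasses.mk) := hf

/-- The number of fixed points of a permutation. -/
def numFix {n : ℕ} (g : Equiv.Perm (Fin n)) : ℕ := (Finset.univ.filter fun x => g x = x).card

theorem numFix_add_card_support {n : ℕ} (g : Equiv.Perm (Fin n)) :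
    numFix g + g.support.card = n := by
  have := Finset.card_filter_add_card_filter_not (s := Finset.univ) (fun x => g x = x)
  rwa [Finset.card_univ, Fintype.card_fin] at this

theorem isIrrChar_numFix_sub_one {n : ℕ} (hn : 2 ≤ n) :
    IsIrrChar (Equiv.Perm (Fin n)) fun g => (numFix g : ℂ) - 1 :=
  ⟨FDRep.of (stdRep n), simple_of_isIrreducible _ (stdRep_isIrreducible hn),
    funext fun g => (stdRep_character n (by omega) g).symm⟩

theorem eq_one_of_forall_conj_eq {n : ℕ} (hn : 3 ≤ n) {y : Equiv.Perm (Fin n)}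
    (hy : ∀ k, k * y * k⁻¹ = y) : y = 1 := by
  ext a
  by_contra hne
  have hne : y a ≠ a := fun h => hne (by rw [h]; rfl)
  obtain ⟨z, hz⟩ : ∃ z, z ∉ ({a, y a} : Finset (Fin n)) := by
    by_contra! hc
    have := Finset.card_le_card (fun x _ => hc x : Finset.univ ⊆ ({a, y a} : Finset (Fin n)))
    have := Finset.card_le_two (a := a) (b := y a)
    rw [Finset.card_univ, Fintype.card_fin] at *
    omega
  simp only [Finset.mem_insert, Finset.mem_singleton, not_or] at hz
  have := congrArg (fun p => p a) (mul_inv_eq_iff_eq_mul.1 (hy (Equiv.swap (y a) z)))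
  simp only [Equiv.Perm.mul_apply, Equiv.swap_apply_left,
    Equiv.swap_apply_of_ne_of_ne hne.symm (Ne.symm hz.1)] at this
  exact hz.2 this

theorem IsTableAut.card_isConj_eq {G : Type} [Group G] [Finite G]
    {σ : Equiv.Perm {f : G → ℂ // IsIrrChar G f}} {τ : Equiv.Perm (ConjClasses G)}
    (h : IsTableAut G σ τ) {x y : G} (hxy : ConjClasses.mk y = τ (ConjClasses.mk x)) :
    Nat.card {k | IsConj y k} = Nat.card {k | IsConj x k} := by
  classical
  have := Fintype.ofFinite G
  have := h.card_eq (ConjClasses.mk x)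
  rw [← hxy] at this
  simp only [ConjClasses.mk_eq_mk_iff_isConj] at this
  simpa only [Nat.card_eq_fintype_card, Fintype.card_subtype, Set.coe_ofPred,
    isConj_comm] using this

section

variable {n : ℕ} {σ : Equiv.Perm {f : Equiv.Perm (Fin n) → ℂ // IsIrrChar (Equiv.Perm (Fin n)) f}}
  {τ : Equiv.Perm (ConjClasses (Equiv.Perm (Fin n)))}

theorem IsTableAut.map_one (hn : 2 ≤ n) (h : IsTableAut (Equiv.Perm (Fin n)) σ τ) :
    τ (ConjClasses.mk 1) = ConjClasses.mk 1 := by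
  obtain ⟨y, hy⟩ := ConjClasses.exists_rep (τ (ConjClasses.mk 1))
  rw [← hy]
  suffices y = 1 by rw [this]
  by_cases hn3 : 3 ≤ n
  · refine eq_one_of_forall_conj_eq hn3 fun k => ?_
    have := h.card_isConj_eq hy
    have h1 : {k | IsConj (1 : Equiv.Perm (Fin n)) k} = {1} := by
      ext; simp [eq_comm]
    rw [h1, Nat.card_unique (α := ({1} : Set (Equiv.Perm (Fin n)))),
      Nat.card_eq_one_iff_unique] at this
    have := this.1
    exact congrArg Subtype.val (Subsingleton.elim (α := {k | IsConj y k})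
      ⟨k * y * k⁻¹, isConj_iff.2 ⟨k, rfl⟩⟩ ⟨y, IsConj.refl y⟩)
  · by_contra hne
    have hirr := isIrrChar_numFix_sub_one hn
    have := (h.isIrrChar_comp hirr.classFun_comp_mk).one_eq
    obtain ⟨m, hm⟩ := this
    rw [Function.comp_apply, Function.comp_apply, ← hy, hirr.classFun_mk] at hm
    have h2 := numFix_add_card_support y
    have := Equiv.Perm.two_le_card_support_of_ne_one hne
    have h0 : numFix y = 0 := by omega
    rw [h0, sub_eq_iff_eq_add] at hm
    norm_cast at hm

theorem IsTableAut.cycleType_eq_two (hn : 2 ≤ n) (h4 : n ≠ 4) (h6 : n ≠ 6)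
    (h : IsTableAut (Equiv.Perm (Fin n)) σ τ) {x y : Equiv.Perm (Fin n)}
    (hxy : ConjClasses.mk y = τ (ConjClasses.mk x)) (hx : x.cycleType = {2}) :
    y.cycleType = {2} := by
  have hy : y ≠ 1 := by
    rintro rfl
    rw [← h.map_one hn, τ.injective.eq_iff, ConjClasses.mk_eq_mk_iff_isConj,
      isConj_one_right] at hxy
    simp [hxy] at hx
  by_cases hn3 : 3 ≤ n
  · exact cycleType_eq_of_card_isConj_eq hn3 h4 h6 hy hx (h.card_isConj_eq hxy)
  · rw [← Equiv.Perm.isSwap_iff_cycleType, ← Equiv.Perm.card_support_eq_two]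
    have := Equiv.Perm.two_le_card_support_of_ne_one hy
    have := numFix_add_card_support y
    omega

theorem IsTableAut.map_swap (hn : 2 ≤ n) (h4 : n ≠ 4) (h6 : n ≠ 6)
    (h : IsTableAut (Equiv.Perm (Fin n)) σ τ) {i j : Fin n} (hij : i ≠ j) :
    τ (ConjClasses.mk (Equiv.swap i j)) = ConjClasses.mk (Equiv.swap i j) := by
  obtain ⟨y, hy⟩ := ConjClasses.exists_rep (τ (ConjClasses.mk (Equiv.swap i j)))
  have ht := Equiv.Perm.isSwap_iff_cycleType.1 ⟨i, j, hij, rfl⟩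
  rw [← hy]
  refine ConjClasses.mk_eq_mk_iff_isConj.2 (Equiv.Perm.isConj_iff_cycleType_eq.2 ?_)
  rw [h.cycleType_eq_two hn h4 h6 hy ht, ht]

end

theorem finrank_range_one_sub_of_trace {V : Type} [AddCommGroup V] [Module ℂ V]
    [FiniteDimensional ℂ V] {A : Module.End ℂ V} (hA : A * A = 1)
    (ht : LinearMap.trace ℂ V A = Module.finrank ℂ V - 2) :
    Module.finrank ℂ (LinearMap.range ((2⁻¹ : ℂ) • (1 - A))) = 1 := by
  have hid : IsIdempotentElem ((2⁻¹ : ℂ) • (1 - A)) := by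
    rw [IsIdempotentElem, smul_mul_smul_comm, mul_sub, sub_mul, sub_mul, hA]
    simp only [one_mul, mul_one]
    rw [show (1 - A - (A - 1) : Module.End ℂ V) = (2 : ℂ) • (1 - A) by
      rw [two_smul]; abel, smul_smul]
    norm_num
  have := (LinearMap.IsIdempotentElem.isProj_range _ hid).trace
  rw [map_smul, map_sub, ht, LinearMap.trace_one, smul_eq_mul] at this
  have h2 : (Module.finrank ℂ (LinearMap.range ((2⁻¹ : ℂ) • (1 - A))) : ℂ) = 1 := by
    rw [← this]; ring
  exact_mod_cast h2

theorem exists_ne_zero_forall_apply_eq {V ι : Type} [AddCommGroup V] [Module ℂ V]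
    [FiniteDimensional ℂ V] (s : Finset ι) (A : ι → Module.End ℂ V) (hA : ∀ i ∈ s, A i * A i = 1)
    (ht : ∀ i ∈ s, LinearMap.trace ℂ V (A i) = Module.finrank ℂ V - 2)
    (hs : s.card < Module.finrank ℂ V) : ∃ v ≠ 0, ∀ i ∈ s, A i v = v := by
  let e : (i : s) → V →ₗ[ℂ] LinearMap.range ((2⁻¹ : ℂ) • (1 - A i)) := fun i =>
    LinearMap.rangeRestrict _
  have hker : LinearMap.ker (LinearMap.pi e) ≠ ⊥ := by
    refine LinearMap.ker_ne_bot_of_finrank_lt ?_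
    rw [Module.finrank_pi_fintype,
      Finset.sum_congr rfl fun (i : s) _ => finrank_range_one_sub_of_trace (hA i i.2) (ht i i.2)]
    simpa using hs
  obtain ⟨v, hv, hv0⟩ := (Submodule.ne_bot_iff _).1 hker
  refine ⟨v, hv0, fun i hi => ?_⟩
  have h1 := congrFun (LinearMap.mem_ker.1 hv) ⟨i, hi⟩
  have h2 : (2⁻¹ : ℂ) • (v - A i v) = 0 := congrArg Subtype.val h1
  rw [smul_eq_zero, sub_eq_zero] at h2
  exact (h2.resolve_left (by norm_num)).symm

theorem apply_eq_of_forall_swap {n : ℕ} {V : Type} [AddCommGroup V] [Module ℂ V]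
    (ρ : Representation ℂ (Equiv.Perm (Fin n)) V) {v : V} {p a : Fin n} (ha : a ≠ p)
    (h : ∀ i, i ≠ a → i ≠ p → ρ (Equiv.swap a i) v = v) (g : Equiv.Perm (Fin n)) (hg : g p = p) :
    ρ g v = v := by
  have hswap : ∀ i j, i ≠ p → j ≠ p → i ≠ j → ρ (Equiv.swap i j) v = v := by
    intro i j hi hj hij
    by_cases hia : i = a
    · subst hia
      exact h j hij.symm hj
    by_cases hja : j = a
    · subst hja
      rw [Equiv.swap_comm]
      exact h i hij hi
    rw [← Equiv.swap_mul_swap_mul_swap hja hij.symm, map_mul, map_mul, Module.End.mul_apply,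
      Module.End.mul_apply, h i hia hi, Equiv.swap_comm j a, h j hja hj, h i hia hi]
  have hgp : ∀ x, g x ≠ p ↔ x ≠ p := fun x => by
    rw [not_iff_not]
    exact ⟨fun hx => g.injective (hx.trans hg.symm), fun hx => hx ▸ hg⟩
  rw [← Equiv.Perm.ofSubtype_subtypePerm (p := fun x => x ≠ p) hgp
    (fun x hx hxp => hx (hxp ▸ hg))]
  generalize g.subtypePerm (p := fun x => x ≠ p) hgp = q
  induction q using Equiv.Perm.swap_induction_on with
  | one => simp
  | swap_mul f x y hxy ih =>
    rw [map_mul, map_mul, Module.End.mul_apply, ih, Equiv.Perm.ofSubtype_swap_eq,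
      hswap _ _ x.2 y.2 (Subtype.coe_injective.ne hxy)]

theorem exists_sum_stabilizer_eq {n : ℕ} {ψ : Equiv.Perm (Fin n) → ℂ}
    (hψ : IsIrrChar (Equiv.Perm (Fin n)) ψ) (h1 : ψ 1 = n - 1)
    (hs : ∀ i j, i ≠ j → ψ (Equiv.swap i j) = n - 3) (hn : 2 ≤ n) (p : Fin n) :
    ∃ m : ℕ, 0 < m ∧ ∑ g : Equiv.Perm (Fin n) with g p = p, ψ g = m := by
  classical
  obtain ⟨V, hV, rfl⟩ := hψ
  have : Nontrivial (Fin n) := Fin.nontrivial_iff_two_le.2 hn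
  obtain ⟨a, ha⟩ := exists_ne p
  rw [FDRep.char_one] at h1
  have hd : Module.finrank ℂ V + 1 = n := by
    have : ((Module.finrank ℂ V + 1 : ℕ) : ℂ) = n := by push_cast; rw [h1]; ring
    exact_mod_cast this
  obtain ⟨v, hv0, hv⟩ := exists_ne_zero_forall_apply_eq ({a, p}ᶜ : Finset (Fin n))
    (fun i => V.ρ (Equiv.swap a i)) (fun i _ => by rw [← map_mul, Equiv.swap_mul_self, map_one])
    (fun i hi => by
      simp only [Finset.mem_compl, Finset.mem_insert, Finset.mem_singleton, not_or] at hi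
      refine (hs a i (Ne.symm hi.1)).trans ?_
      rw [h1]; ring)
    (by
      rw [Finset.card_compl, Finset.card_pair ha, Fintype.card_fin]
      omega)
  have hfix := apply_eq_of_forall_swap V.ρ ha
    (fun i h1 h2 => hv i (by simp [h1, h2]))
  let H := MulAction.stabilizer (Equiv.Perm (Fin n)) p
  let W : FDRep ℂ H := FDRep.of (V.ρ.comp H.subtype)
  have hW := W.average_char_eq_finrank_invariants
  have hpos : 0 < Module.finrank ℂ (Representation.invariants W.ρ) := by
    have : Nontrivial (Representation.invariants W.ρ) :=
      ⟨⟨v, fun g => hfix g g.2⟩, 0, fun h => hv0 (congrArg Subtype.val h)⟩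
    exact Module.finrank_pos
  have hc : (Nat.card H : ℂ) ≠ 0 := Nat.cast_ne_zero.2 Nat.card_pos.ne'
  refine ⟨Nat.card H * Module.finrank ℂ (Representation.invariants W.ρ),
    Nat.mul_pos Nat.card_pos hpos, ?_⟩
  rw [Nat.cast_mul, ← hW, mul_inv_cancel_left₀ hc]
  exact Finset.sum_subtype _ (by simp [H]) _

theorem numFix_inv {n : ℕ} (g : Equiv.Perm (Fin n)) : numFix g⁻¹ = numFix g := by
  have h1 := numFix_add_card_support g
  have h2 := numFix_add_card_support g⁻¹
  rw [Equiv.Perm.support_inv] at h2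
  omega

/-- An irreducible character of `S_n` which takes the same values as the standard character at the
identity and the transpositions is the standard character. -/
theorem IsIrrChar.eq_numFix_sub_one {n : ℕ} {ψ : Equiv.Perm (Fin n) → ℂ}
    (hψ : IsIrrChar (Equiv.Perm (Fin n)) ψ) (h1 : ψ 1 = n - 1)
    (hs : ∀ i j, i ≠ j → ψ (Equiv.swap i j) = n - 3) (hn : 2 ≤ n) :
    ψ = fun g => (numFix g : ℂ) - 1 := by
  classical
  have hψ1 : ψ ≠ 1 := by
    rintro rfl
    have h2 := hs ⟨0, by omega⟩ ⟨1, by omega⟩ (by simp)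
    simp only [Pi.one_apply] at h1 h2
    rw [h1] at h2
    norm_num at h2
  choose m hm hsum using exists_sum_stabilizer_eq hψ h1 hs hn
  have e1 : ∑ g, ψ g * numFix g = (∑ p, m p : ℕ) := by
    rw [Nat.cast_sum, Finset.sum_congr rfl fun p _ => (hsum p).symm]
    simp only [numFix, Finset.card_filter, Nat.cast_sum, Finset.mul_sum, Finset.sum_filter]
    rw [Finset.sum_comm]
    simp
  have hpos : 0 < ∑ p, m p := Finset.sum_pos (fun p _ => hm p) ⟨⟨0, by omega⟩, Finset.mem_univ _⟩
  have e2 := hψ.sum_eq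
  have e3 := hψ.sum_mul_inv (isIrrChar_numFix_sub_one hn)
  simp only [numFix_inv, mul_sub, mul_one, Finset.sum_sub_distrib, e1, e2, if_neg hψ1, sub_zero]
    at e3
  by_contra hne
  rw [if_neg hne] at e3
  exact hpos.ne' (by exact_mod_cast e3)

theorem numFix_one {n : ℕ} : numFix (1 : Equiv.Perm (Fin n)) = n := by
  simp [numFix]

theorem numFix_swap {n : ℕ} {i j : Fin n} (hij : i ≠ j) : numFix (Equiv.swap i j) + 2 = n := by
  rw [← Equiv.Perm.card_support_swap hij]
  exact numFix_add_card_support _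

theorem IsTableAut.numFix_eq {n : ℕ}
    {σ : Equiv.Perm {f : Equiv.Perm (Fin n) → ℂ // IsIrrChar (Equiv.Perm (Fin n)) f}}
    {τ : Equiv.Perm (ConjClasses (Equiv.Perm (Fin n)))} (hn : 2 ≤ n) (h4 : n ≠ 4) (h6 : n ≠ 6)
    (h : IsTableAut (Equiv.Perm (Fin n)) σ τ) {x y : Equiv.Perm (Fin n)}
    (hxy : ConjClasses.mk y = τ (ConjClasses.mk x)) : numFix y = numFix x := by
  have hirr := isIrrChar_numFix_sub_one hn
  have := (h.isIrrChar_comp hirr.classFun_comp_mk).eq_numFix_sub_one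
    (by simp only [Function.comp_apply, h.map_one hn, hirr.classFun_mk, numFix_one])
    (fun i j hij => by
      simp only [Function.comp_apply, h.map_swap hn h4 h6 hij, hirr.classFun_mk]
      have := numFix_swap hij
      have : ((numFix (Equiv.swap i j) + 2 : ℕ) : ℂ) = n := congrArg _ this
      rw [← this]
      push_cast
      ring) hn
  have := congrFun this x
  rw [Function.comp_apply, Function.comp_apply, ← hxy, hirr.classFun_mk] at this
  exact_mod_cast sub_left_injective this

theorem cycleType_eq_singleton_iff {n k : ℕ} {g : Equiv.Perm (Fin n)} :
    g.cycleType = {k} ↔ g.IsCycle ∧ g.support.card = k := by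
  constructor
  · intro h
    refine ⟨Equiv.Perm.card_cycleType_eq_one.1 (by rw [h, Multiset.card_singleton]), ?_⟩
    rw [← Equiv.Perm.sum_cycleType, h, Multiset.sum_singleton]
  · rintro ⟨h, rfl⟩
    exact h.cycleType

/-- Inserting a fixed point into a cycle gives a cycle. -/
theorem isCycle_mul_swap {n : ℕ} {z : Equiv.Perm (Fin n)} (hz : z.IsCycle) {a b : Fin n}
    (ha : z a ≠ a) (hb : z b = b) : (z * Equiv.swap a b).IsCycle := by
  have hab : a ≠ b := fun h => ha (by rw [h, hb])
  have hxa : (z * Equiv.swap a b) a = b := by simp [hb]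
  have hxb : (z * Equiv.swap a b) b = z a := by simp
  have hx : ∀ w, w ≠ a → w ≠ b → (z * Equiv.swap a b) w = z w := fun w h1 h2 => by
    rw [Equiv.Perm.mul_apply, Equiv.swap_apply_of_ne_of_ne h1 h2]
  have hsb : (z * Equiv.swap a b).SameCycle a b := ⟨1, by rw [zpow_one, hxa]⟩
  have key : ∀ i : ℕ, (z * Equiv.swap a b).SameCycle a ((z ^ i) a) := by
    intro i
    induction i with
    | zero => exact Equiv.Perm.SameCycle.refl _ _
    | succ i ih =>
      rw [pow_succ', Equiv.Perm.mul_apply]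
      by_cases hw : (z ^ i) a = a
      · rw [hw, ← hxb, Equiv.Perm.sameCycle_apply_right]
        exact hsb
      · have hwb : (z ^ i) a ≠ b := fun h => by
          rw [← Equiv.Perm.eq_inv_iff_eq, ← inv_pow,
            Equiv.Perm.pow_apply_eq_self_of_apply_eq_self] at h
          · exact hab h
          · rw [Equiv.Perm.inv_eq_iff_eq, hb]
        rw [← hx _ hw hwb, Equiv.Perm.sameCycle_apply_right]
        exact ih
  refine ⟨a, by rw [hxa]; exact hab.symm, fun y hy => ?_⟩
  by_cases hya : y = a
  · rw [hya]
  by_cases hyb : y = b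
  · rwa [hyb]
  rw [hx y hya hyb] at hy
  obtain ⟨i, rfl⟩ := hz.exists_pow_eq ha hy
  exact key i

theorem cycleType_eq_singleton_succ_iff {n k : ℕ} (hk : 2 ≤ k) {g : Equiv.Perm (Fin n)} :
    g.cycleType = {k + 1} ↔ g.support.card = k + 1 ∧
      ∃ t : Equiv.Perm (Fin n), t.cycleType = {2} ∧ (g * t).cycleType = {k} := by
  simp only [cycleType_eq_singleton_iff (k := k), cycleType_eq_singleton_iff (k := k + 1)]
  constructor
  · rintro ⟨hg, hc⟩
    obtain ⟨a, ha, -⟩ := id hg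
    have haa : g (g a) ≠ a := fun h => by
      have h2 := Equiv.Perm.card_support_swap (Ne.symm ha)
      rw [← hg.eq_swap_of_apply_apply_eq_self ha h] at h2
      omega
    have hgt : g * Equiv.swap (g⁻¹ a) a = Equiv.swap a (g a) * g := by
      rw [Equiv.mul_swap_eq_swap_mul, Equiv.Perm.inv_def, Equiv.apply_symm_apply]
    refine ⟨hc, Equiv.swap (g⁻¹ a) a,
      Equiv.Perm.isSwap_iff_cycleType.1 ⟨_, _, fun h => ?_, rfl⟩, ?_⟩
    · exact ha ((Equiv.Perm.inv_eq_iff_eq.1 h).symm)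
    · rw [hgt]
      refine ⟨hg.swap_mul ha haa, ?_⟩
      rw [Equiv.Perm.support_swap_mul_eq g a haa,
        Finset.card_sdiff_of_subset (by simpa using ha), hc, Finset.card_singleton,
        Nat.add_sub_cancel]
  · rintro ⟨hc, t, ht, hz, hzc⟩
    refine ⟨?_, hc⟩
    obtain ⟨a, b, hab, rfl⟩ := Equiv.Perm.isSwap_iff_cycleType.2 ht
    obtain ⟨z, rfl⟩ : ∃ z, g = z * Equiv.swap a b := ⟨g * Equiv.swap a b, by simp⟩
    rw [mul_assoc, Equiv.swap_mul_self, mul_one] at hz hzc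
    by_cases ha : z a = a
    · by_cases hb : z b = b
      · exfalso
        have hd : Equiv.Perm.Disjoint z (Equiv.swap a b) := fun x => by
          by_cases hxa : x = a
          · exact Or.inl (by rw [hxa, ha])
          by_cases hxb : x = b
          · exact Or.inl (by rw [hxb, hb])
          exact Or.inr (Equiv.swap_apply_of_ne_of_ne hxa hxb)
        rw [hd.card_support_mul, hzc, Equiv.Perm.card_support_swap hab] at hc
        omega
      · rw [Equiv.swap_comm]
        exact isCycle_mul_swap hz hb ha
    · by_cases hb : z b = b
      · exact isCycle_mul_swap hz ha hb
      · exfalso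
        have h1 : (z * Equiv.swap a b).support ⊆ z.support := by
          refine (Equiv.Perm.support_mul_le _ _).trans (sup_le le_rfl ?_)
          rw [Equiv.Perm.support_swap hab]
          intro x hx
          rcases Finset.mem_insert.1 hx with rfl | hx
          · exact Equiv.Perm.mem_support.2 ha
          · rw [Finset.mem_singleton.1 hx]
            exact Equiv.Perm.mem_support.2 hb
        have := Finset.card_le_card h1
        omega

theorem mem_cycleFactorsFinset_iff_numFix {n : ℕ} {g z : Equiv.Perm (Fin n)} (hz : z.IsCycle) :
    z ∈ g.cycleFactorsFinset ↔ numFix (g * z⁻¹) = numFix g + z.support.card := by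
  have h1 := numFix_add_card_support g
  have h2 := numFix_add_card_support (g * z⁻¹)
  constructor
  · intro h
    have hd := (Equiv.Perm.disjoint_mul_inv_of_mem_cycleFactorsFinset h).card_support_mul
    rw [inv_mul_cancel_right] at hd
    omega
  · intro h
    have h3 : g.support ⊆ (g * z⁻¹).support ∪ z.support := by
      have := Equiv.Perm.support_mul_le (g * z⁻¹) z
      rwa [inv_mul_cancel_right] at this
    have h4 := Finset.card_le_card h3
    have h5 := Finset.card_union_add_card_inter (g * z⁻¹).support z.support
    have h6 : ((g * z⁻¹).support ∩ z.support).card = 0 := by omega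
    rw [Finset.card_eq_zero, ← Finset.disjoint_iff_inter_eq_empty] at h6
    refine Equiv.Perm.mem_cycleFactorsFinset_iff.2 ⟨hz, fun a ha => ?_⟩
    have h7 := Finset.disjoint_right.1 h6 (Equiv.Perm.apply_mem_support.2 ha)
    rw [Equiv.Perm.notMem_support, Equiv.Perm.mul_apply, Equiv.Perm.inv_def,
      Equiv.symm_apply_apply] at h7
    exact h7.symm

theorem count_cycleType_eq {n k : ℕ} (g : Equiv.Perm (Fin n)) :
    g.cycleType.count k = (Finset.univ.filter fun z : Equiv.Perm (Fin n) =>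
      z.cycleType = {k} ∧ numFix (g * z) = numFix g + k).card := by
  rw [Equiv.Perm.cycleType, Multiset.count_map]
  change (g.cycleFactorsFinset.filter fun z => k = z.support.card).card = _
  refine Finset.card_bij (fun z _ => z⁻¹) (fun z hz => ?_) (fun _ _ _ _ h => inv_injective h)
    fun z hz => ?_
  · obtain ⟨hzg, rfl⟩ := Finset.mem_filter.1 hz
    have hc := (Equiv.Perm.mem_cycleFactorsFinset_iff.1 hzg).1
    simp only [Finset.mem_filter, Finset.mem_univ, true_and, Equiv.Perm.cycleType_inv, hc.cycleType]
    exact (mem_cycleFactorsFinset_iff_numFix hc).1 hzg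
  · simp only [Finset.mem_filter, Finset.mem_univ, true_and] at hz
    obtain ⟨hz, hf⟩ := hz
    rw [← Equiv.Perm.cycleType_inv, cycleType_eq_singleton_iff] at hz
    obtain ⟨hz, rfl⟩ := hz
    refine ⟨z⁻¹, Finset.mem_filter.2 ⟨(mem_cycleFactorsFinset_iff_numFix hz).2 ?_, rfl⟩, inv_inv z⟩
    rw [inv_inv, hf]

section

variable {n : ℕ} {σ : Equiv.Perm {f : Equiv.Perm (Fin n) → ℂ // IsIrrChar (Equiv.Perm (Fin n)) f}}
  {τ : Equiv.Perm (ConjClasses (Equiv.Perm (Fin n)))}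

theorem IsTableAut.cycleType_eq_singleton_iff (hn : 2 ≤ n) (h4 : n ≠ 4) (h6 : n ≠ 6)
    (h : IsTableAut (Equiv.Perm (Fin n)) σ τ) {k : ℕ} (hk : 2 ≤ k) (x y : Equiv.Perm (Fin n))
    (hxy : ConjClasses.mk y = τ (ConjClasses.mk x)) :
    y.cycleType = {k} ↔ x.cycleType = {k} := by
  have hs : ∀ x y : Equiv.Perm (Fin n), ConjClasses.mk y = τ (ConjClasses.mk x) →
      y.support.card = x.support.card := fun x y hxy => by
    have h1 := h.numFix_eq hn h4 h6 hxy
    have h2 := numFix_add_card_support x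
    have h3 := numFix_add_card_support y
    omega
  induction k, hk using Nat.le_induction generalizing x y with
  | base =>
    rw [← Equiv.Perm.isSwap_iff_cycleType, ← Equiv.Perm.isSwap_iff_cycleType,
      ← Equiv.Perm.card_support_eq_two, ← Equiv.Perm.card_support_eq_two, hs x y hxy]
  | succ k hk ih =>
    have h01 : (⟨0, by omega⟩ : Fin n) ≠ ⟨1, by omega⟩ := by simp
    have := h.card_mul_right_of_iff (h.map_one hn) (h.map_swap hn h4 h6 h01)
      (Q := fun t => t.cycleType = {2}) (P := fun t => t.cycleType = {k}) (fun t => by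
        rw [Equiv.Perm.isConj_iff_cycleType_eq,
          Equiv.Perm.isSwap_iff_cycleType.1 (Equiv.Perm.swap_isSwap_iff.2 h01)])
      ih hxy
    rw [cycleType_eq_singleton_succ_iff hk, cycleType_eq_singleton_succ_iff hk, hs x y hxy]
    refine and_congr_right fun _ => ?_
    have he : ∀ g : Equiv.Perm (Fin n),
        (∃ t : Equiv.Perm (Fin n), t.cycleType = {2} ∧ (g * t).cycleType = {k}) ↔
        (Finset.univ.filter fun t : Equiv.Perm (Fin n) =>
          t.cycleType = {2} ∧ (g * t).cycleType = {k}).card ≠ 0 := fun g => by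
      simp [Finset.filter_eq_empty_iff]
    rw [he, he, this]

theorem IsTableAut.cycleType_eq (hn : 2 ≤ n) (h4 : n ≠ 4) (h6 : n ≠ 6)
    (h : IsTableAut (Equiv.Perm (Fin n)) σ τ) {x y : Equiv.Perm (Fin n)}
    (hxy : ConjClasses.mk y = τ (ConjClasses.mk x)) : y.cycleType = x.cycleType := by
  ext k
  rw [count_cycleType_eq, count_cycleType_eq]
  by_cases hex : ∃ t : Equiv.Perm (Fin n), t.cycleType = {k}
  · obtain ⟨t, ht⟩ := hex
    have hk : 2 ≤ k := Equiv.Perm.two_le_of_mem_cycleType (σ := t) (by simp [ht])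
    obtain ⟨s, hs⟩ := ConjClasses.exists_rep (τ (ConjClasses.mk t))
    have hst : τ (ConjClasses.mk t) = ConjClasses.mk t := by
      rw [← hs]
      refine ConjClasses.mk_eq_mk_iff_isConj.2 (Equiv.Perm.isConj_iff_cycleType_eq.2 ?_)
      rw [ht, (h.cycleType_eq_singleton_iff hn h4 h6 hk t s hs).2 ht]
    rw [h.numFix_eq hn h4 h6 hxy]
    exact (h.card_mul_right_of_iff (h.map_one hn) hst (Q := fun t => t.cycleType = {k})
      (P := fun t => numFix t = numFix x + k)
      (fun t => by rw [Equiv.Perm.isConj_iff_cycleType_eq, ht])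
      (fun a b hab => by rw [h.numFix_eq hn h4 h6 hab]) hxy).symm
  · push Not at hex
    simp [hex]

end

theorem table_aut_symmetricGroup_trivial (n : ℕ) (h4 : n ≠ 4) (h6 : n ≠ 6)
    (σ : Equiv.Perm {f : Equiv.Perm (Fin n) → ℂ // IsIrrChar (Equiv.Perm (Fin n)) f})
    (τ : Equiv.Perm (ConjClasses (Equiv.Perm (Fin n))))
    (h : IsTableAut (Equiv.Perm (Fin n)) σ τ) :
    σ = Equiv.refl _ ∧ τ = Equiv.refl _ := by
  have hτ : ∀ c, τ c = c := by
    intro c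
    obtain ⟨x, rfl⟩ := ConjClasses.exists_rep c
    obtain ⟨y, hy⟩ := ConjClasses.exists_rep (τ (ConjClasses.mk x))
    rw [← hy]
    refine ConjClasses.mk_eq_mk_iff_isConj.2 (Equiv.Perm.isConj_iff_cycleType_eq.2 ?_)
    by_cases hn : 2 ≤ n
    · exact h.cycleType_eq hn h4 h6 hy
    · have : Subsingleton (Fin n) := Fin.subsingleton_iff_le_one.2 (by omega)
      rw [Subsingleton.elim y x]
  refine ⟨Equiv.ext fun f => Subtype.ext (funext fun g => ?_), Equiv.ext hτ⟩
  exact h f g g (hτ _).symm
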